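/- Let Markov-parameter data S_{q,q0,j}(w), S_{f,q}(w) for an index set Φ over a finite mode set Q be given, and let N > 0. If the span of the columns of the full Hankel matrix H_Φ is finite-dimensional with dimension equal to rank H_{Φ,N,N}, then rank H_{Φ,N,N} = rank H_{Φ,N+1,N} = rank H_{Φ,N,N+1} and there exists a complete LSS realization of the Markov data of dimension rank H_{Φ,N,N}, which is minimal (every complete realization has dimension ≥ rank H_{Φ,N,N}). Moreover, if there exists a complete LSS realization (Σ, μ) of the Markov data with dim Σ ≤ N+1, then the span of the columns of H_Φ is finite-dimensional with dimension equal to rank H_{Φ,N,N}. -/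

import Mathlib

open Matrix

section LssDefs

variable {Q Φ : Type*} {p m : ℕ}

/-- `A_w = A_{q_k} ⋯ A_{q_1}` for the word `w = q_1 ⋯ q_k`. -/
def wordProd {Q : Type*} {n : ℕ} (A : Q → Matrix (Fin n) (Fin n) ℝ) :
    List Q → Matrix (Fin n) (Fin n) ℝ
  | [] => 1
  | q :: w => wordProd A w * A q

/-- Entry data of the Hankel matrix of the Markov-parameter data `(S1, S2)`:
`S1 q q0 z w = S_{q,q0,z}(w)` and `S2 f q w = S_{f,q}(w)`.  The column index `j` ranges
over `J_Φ = Φ ⊕ (Q × {1,…,m})`, the row block is indexed by `q' ∈ Q` (the enumeration of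
`{1,…,pD}` as `Q × Fin p`) together with `r ∈ Fin p`. -/
def lssEntry (S1 : Q → Q → Fin m → List Q → Fin p → ℝ)
    (S2 : Φ → Q → List Q → Fin p → ℝ)
    (j : Φ ⊕ Q × Fin m) (u : List Q) (q' : Q) (r : Fin p) : ℝ :=
  match j with
  | Sum.inl f => S2 f q' u r
  | Sum.inr (q, z) => S1 q' q z u r

/-- Span of the columns of the full Hankel matrix `H_Φ`. -/
def lssFullSpan (S1 : Q → Q → Fin m → List Q → Fin p → ℝ)
    (S2 : Φ → Q → List Q → Fin p → ℝ) : Submodule ℝ (List Q × Q × Fin p → ℝ) :=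
  Submodule.span ℝ (Set.range fun wj : List Q × (Φ ⊕ Q × Fin m) =>
    fun vqr : List Q × Q × Fin p =>
      lssEntry S1 S2 wj.2 (wj.1 ++ vqr.1) vqr.2.1 vqr.2.2)

/-- `rank H_{Φ,L,M}` : dimension of the span of the columns of the sub-Hankel matrix
whose rows are indexed by `(v,i)` with `|v| ≤ L` and whose columns are indexed by
`(w,j)` with `|w| ≤ M`. -/
noncomputable def lssHankelRank (S1 : Q → Q → Fin m → List Q → Fin p → ℝ)
    (S2 : Φ → Q → List Q → Fin p → ℝ) (L M : ℕ) : ℕ :=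
  Module.finrank ℝ (Submodule.span ℝ
    (Set.range fun wj : {w : List Q // w.length ≤ M} × (Φ ⊕ Q × Fin m) =>
      fun vqr : {v : List Q // v.length ≤ L} × Q × Fin p =>
        lssEntry S1 S2 wj.2 (wj.1.1 ++ vqr.1.1) vqr.2.1 vqr.2.2))

/-- `(Σ, μ)` is an `N`-partial LSS realization of the Markov-parameter data. -/
def IsLssPartialRealization (S1 : Q → Q → Fin m → List Q → Fin p → ℝ)
    (S2 : Φ → Q → List Q → Fin p → ℝ) (N : ℕ) {n : ℕ}
    (A : Q → Matrix (Fin n) (Fin n) ℝ) (B : Q → Matrix (Fin n) (Fin m) ℝ)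
    (C : Q → Matrix (Fin p) (Fin n) ℝ) (μ : Φ → Fin n → ℝ) : Prop :=
  ∀ w : List Q, w.length ≤ N →
    (∀ (q q0 : Q) (z : Fin m),
      S1 q q0 z w = (C q).mulVec ((wordProd A w).mulVec (fun i => B q0 i z))) ∧
    (∀ (f : Φ) (q : Q), S2 f q w = (C q).mulVec ((wordProd A w).mulVec (μ f)))

/-- `(Σ, μ)` is a complete LSS realization of the Markov-parameter data. -/
def IsLssRealization (S1 : Q → Q → Fin m → List Q → Fin p → ℝ)
    (S2 : Φ → Q → List Q → Fin p → ℝ) {n : ℕ}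
    (A : Q → Matrix (Fin n) (Fin n) ℝ) (B : Q → Matrix (Fin n) (Fin m) ℝ)
    (C : Q → Matrix (Fin p) (Fin n) ℝ) (μ : Φ → Fin n → ℝ) : Prop :=
  ∀ w : List Q,
    (∀ (q q0 : Q) (z : Fin m),
      S1 q q0 z w = (C q).mulVec ((wordProd A w).mulVec (fun i => B q0 i z))) ∧
    (∀ (f : Φ) (q : Q), S2 f q w = (C q).mulVec ((wordProd A w).mulVec (μ f)))

end LssDefs

section Hankel

variable {Q Φ : Type*} {p m : ℕ}

/-- The column of the Hankel matrix with index `wj`. -/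
def hankelColumn (S1 : Q → Q → Fin m → List Q → Fin p → ℝ)
    (S2 : Φ → Q → List Q → Fin p → ℝ) (wj : List Q × (Φ ⊕ Q × Fin m)) :
    List Q × Q × Fin p → ℝ :=
  fun vqr => lssEntry S1 S2 wj.2 (wj.1 ++ vqr.1) vqr.2.1 vqr.2.2

/-- Span of the columns of `H_Φ` indexed by words of length at most `M`. -/
def hankelSpanLE (S1 : Q → Q → Fin m → List Q → Fin p → ℝ)
    (S2 : Φ → Q → List Q → Fin p → ℝ) (M : ℕ) : Submodule ℝ (List Q × Q × Fin p → ℝ) :=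
  Submodule.span ℝ (hankelColumn S1 S2 '' {wj | wj.1.length ≤ M})

/-- Restriction of a column to the rows indexed by words of length at most `L`. -/
def restrictRows (Q : Type*) (p L : ℕ) :
    (List Q × Q × Fin p → ℝ) →ₗ[ℝ] ({v : List Q // v.length ≤ L} × Q × Fin p → ℝ) :=
  LinearMap.funLeft ℝ ℝ (Prod.map Subtype.val id)

/-- The shift `c ↦ (v ↦ c (q v))` of columns. -/
def shiftRows (p : ℕ) (q : Q) : (List Q × Q × Fin p → ℝ) →ₗ[ℝ] (List Q × Q × Fin p → ℝ) :=
  LinearMap.funLeft ℝ ℝ (Prod.map (List.cons q) id)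

variable (S1 : Q → Q → Fin m → List Q → Fin p → ℝ) (S2 : Φ → Q → List Q → Fin p → ℝ)

lemma lssFullSpan_eq : lssFullSpan S1 S2 = Submodule.span ℝ (Set.range (hankelColumn S1 S2)) :=
  rfl

lemma hankelSpanLE_mono : Monotone (hankelSpanLE S1 S2) := fun _ _ h =>
  Submodule.span_mono (Set.image_mono fun _ hw => le_trans hw h)

lemma hankelSpanLE_le_lssFullSpan (M : ℕ) : hankelSpanLE S1 S2 M ≤ lssFullSpan S1 S2 :=
  Submodule.span_mono (Set.image_subset_range _ _)

lemma lssHankelRank_eq (L M : ℕ) : lssHankelRank S1 S2 L M =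
    Module.finrank ℝ ((hankelSpanLE S1 S2 M).map (restrictRows Q p L)) := by
  have h : (Set.range fun wj : {w : List Q // w.length ≤ M} × (Φ ⊕ Q × Fin m) =>
      fun vqr : {v : List Q // v.length ≤ L} × Q × Fin p =>
        lssEntry S1 S2 wj.2 (wj.1.1 ++ vqr.1.1) vqr.2.1 vqr.2.2) =
      restrictRows Q p L '' (hankelColumn S1 S2 '' {wj | wj.1.length ≤ M}) := by
    ext c
    constructor
    · rintro ⟨⟨⟨w, hw⟩, j⟩, rfl⟩
      exact ⟨_, ⟨(w, j), hw, rfl⟩, rfl⟩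
    · rintro ⟨_, ⟨⟨w, j⟩, hw, rfl⟩, rfl⟩
      exact ⟨(⟨w, hw⟩, j), rfl⟩
  rw [lssHankelRank, h, hankelSpanLE, Submodule.map_span]

lemma lssHankelRank_le_finrank [FiniteDimensional ℝ (lssFullSpan S1 S2)] (L M : ℕ) :
    lssHankelRank S1 S2 L M ≤ Module.finrank ℝ (lssFullSpan S1 S2) := by
  have := Submodule.finiteDimensional_of_le (hankelSpanLE_le_lssFullSpan S1 S2 M)
  rw [lssHankelRank_eq]
  exact (Submodule.finrank_map_le _ _).trans
    (Submodule.finrank_mono (hankelSpanLE_le_lssFullSpan S1 S2 M))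

lemma lssHankelRank_mono_left [FiniteDimensional ℝ (lssFullSpan S1 S2)] {L L' : ℕ} (h : L ≤ L')
    (M : ℕ) : lssHankelRank S1 S2 L M ≤ lssHankelRank S1 S2 L' M := by
  have := Submodule.finiteDimensional_of_le (hankelSpanLE_le_lssFullSpan S1 S2 M)
  let incl (v : {v : List Q // v.length ≤ L}) : {v : List Q // v.length ≤ L'} :=
    ⟨v.1, v.2.trans h⟩
  have hcomp : restrictRows Q p L =
      LinearMap.funLeft ℝ ℝ (Prod.map incl id) ∘ₗ restrictRows Q p L' := rfl
  rw [lssHankelRank_eq, lssHankelRank_eq, hcomp, Submodule.map_comp]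
  exact Submodule.finrank_map_le _ _

lemma lssHankelRank_mono_right [FiniteDimensional ℝ (lssFullSpan S1 S2)] (L : ℕ) {M M' : ℕ}
    (h : M ≤ M') : lssHankelRank S1 S2 L M ≤ lssHankelRank S1 S2 L M' := by
  have := Submodule.finiteDimensional_of_le (hankelSpanLE_le_lssFullSpan S1 S2 M')
  rw [lssHankelRank_eq, lssHankelRank_eq]
  exact Submodule.finrank_mono (Submodule.map_mono (hankelSpanLE_mono S1 S2 h))

lemma hankelColumn_mem (wj : List Q × (Φ ⊕ Q × Fin m)) :
    hankelColumn S1 S2 wj ∈ lssFullSpan S1 S2 :=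
  Submodule.subset_span ⟨wj, rfl⟩

lemma shiftRows_hankelColumn (q : Q) (w : List Q) (j : Φ ⊕ Q × Fin m) :
    shiftRows p q (hankelColumn S1 S2 (w, j)) = hankelColumn S1 S2 (w ++ [q], j) := by
  ext ⟨v, q', r⟩
  simp [shiftRows, hankelColumn, LinearMap.funLeft_apply]

lemma shiftRows_mem (q : Q) :
    ∀ c ∈ lssFullSpan S1 S2, shiftRows p q c ∈ lssFullSpan S1 S2 := by
  change lssFullSpan S1 S2 ≤ (lssFullSpan S1 S2).comap (shiftRows p q)
  rw [lssFullSpan_eq, Submodule.span_le]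
  rintro _ ⟨⟨w, j⟩, rfl⟩
  rw [SetLike.mem_coe, Submodule.mem_comap, shiftRows_hankelColumn]
  exact hankelColumn_mem S1 S2 _

/-- A finite-dimensional Hankel column space is the state space of a complete realization whose
state maps are the shifts. -/
theorem exists_isLssRealization {n : ℕ} (b : Module.Basis (Fin n) ℝ (lssFullSpan S1 S2)) :
    ∃ (A : Q → Matrix (Fin n) (Fin n) ℝ) (B : Q → Matrix (Fin n) (Fin m) ℝ)
      (C : Q → Matrix (Fin p) (Fin n) ℝ) (μ : Φ → Fin n → ℝ),
      IsLssRealization S1 S2 A B C μ := by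
  let x (j : Φ ⊕ Q × Fin m) : lssFullSpan S1 S2 := ⟨_, hankelColumn_mem S1 S2 ([], j)⟩
  let T (q : Q) := (shiftRows p q).restrict (shiftRows_mem S1 S2 q)
  let out (q : Q) : lssFullSpan S1 S2 →ₗ[ℝ] (Fin p → ℝ) :=
    LinearMap.funLeft ℝ ℝ (fun r => (([] : List Q), q, r)) ∘ₗ (lssFullSpan S1 S2).subtype
  let A (q : Q) := LinearMap.toMatrix b b (T q)
  let C (q : Q) := LinearMap.toMatrix b (Pi.basisFun ℝ (Fin p)) (out q)
  have hA (w : List Q) (y : lssFullSpan S1 S2) (q : Q) (r : Fin p) :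
      (C q *ᵥ (wordProd A w *ᵥ b.repr y)) r = y.1 (w, q, r) := by
    induction w generalizing y with
    | nil =>
      rw [wordProd, Matrix.one_mulVec, LinearMap.toMatrix_mulVec_repr]
      rfl
    | cons q' w ih =>
      rw [wordProd, ← Matrix.mulVec_mulVec, LinearMap.toMatrix_mulVec_repr, ih]
      rfl
  refine ⟨A, fun q => .of fun i z => b.repr (x (.inr (q, z))) i, C,
    fun f => b.repr (x (.inl f)), fun w => ⟨fun q q0 z => ?_, fun f q => ?_⟩⟩
  · ext r
    exact (hA w (x (.inr (q0, z))) q r).symm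
  · ext r
    exact (hA w (x (.inl f)) q r).symm

end Hankel

section Realization

variable {Q Φ : Type*} {p m n : ℕ}

lemma wordProd_append (A : Q → Matrix (Fin n) (Fin n) ℝ) (w v : List Q) :
    wordProd A (w ++ v) = wordProd A v * wordProd A w := by
  induction w with
  | nil => simp [wordProd]
  | cons q w ih => simp [wordProd, ih, Matrix.mul_assoc]

/-- The map sending a state to all of its zero-input outputs. -/
def outputMap (A : Q → Matrix (Fin n) (Fin n) ℝ) (C : Q → Matrix (Fin p) (Fin n) ℝ) :
    (Fin n → ℝ) →ₗ[ℝ] (List Q × Q × Fin p → ℝ) :=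
  LinearMap.pi fun vqr =>
    LinearMap.proj vqr.2.2 ∘ₗ (C vqr.2.1).mulVecLin ∘ₗ (wordProd A vqr.1).mulVecLin

lemma outputMap_apply (A : Q → Matrix (Fin n) (Fin n) ℝ) (C : Q → Matrix (Fin p) (Fin n) ℝ)
    (x : Fin n → ℝ) (vqr : List Q × Q × Fin p) :
    outputMap A C x vqr = (C vqr.2.1 *ᵥ (wordProd A vqr.1 *ᵥ x)) vqr.2.2 :=
  rfl

lemma outputMap_mulVec (A : Q → Matrix (Fin n) (Fin n) ℝ) (C : Q → Matrix (Fin p) (Fin n) ℝ)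
    (q : Q) (x : Fin n → ℝ) (v : List Q) (i : Q × Fin p) :
    outputMap A C (A q *ᵥ x) (v, i) = outputMap A C x (q :: v, i) := by
  simp [outputMap_apply, wordProd, Matrix.mulVec_mulVec]

/-- The initial states together with the columns of the input matrices. -/
def initialVector (B : Q → Matrix (Fin n) (Fin m) ℝ) (μ : Φ → Fin n → ℝ) :
    Φ ⊕ Q × Fin m → Fin n → ℝ :=
  Sum.elim μ fun qz i => B qz.1 i qz.2

/-- The state reached from the vector indexed by `wj.2` along the word `wj.1`. -/
def reachedState (A : Q → Matrix (Fin n) (Fin n) ℝ) {J : Type*} (x : J → Fin n → ℝ)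
    (wj : List Q × J) : Fin n → ℝ :=
  wordProd A wj.1 *ᵥ x wj.2

/-- Span of the states reached along words of length less than `k`. -/
def reachableLT (A : Q → Matrix (Fin n) (Fin n) ℝ) {J : Type*} (x : J → Fin n → ℝ) (k : ℕ) :
    Submodule ℝ (Fin n → ℝ) :=
  Submodule.span ℝ (reachedState A x '' {wj | wj.1.length < k})

/-- States whose zero-input outputs vanish along all words of length less than `k`. -/
def unobservableLT (A : Q → Matrix (Fin n) (Fin n) ℝ) (C : Q → Matrix (Fin p) (Fin n) ℝ)
    (k : ℕ) : Submodule ℝ (Fin n → ℝ) where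
  carrier := {x | ∀ v : List Q, v.length < k → ∀ i : Q × Fin p, outputMap A C x (v, i) = 0}
  zero_mem' := by simp
  add_mem' hx hy v hv i := by simp [hx v hv i, hy v hv i]
  smul_mem' c x hx v hv i := by simp [hx v hv i]

variable (A : Q → Matrix (Fin n) (Fin n) ℝ)

lemma reachableLT_mono {J : Type*} (x : J → Fin n → ℝ) : Monotone (reachableLT A x) :=
  fun _ _ h => Submodule.span_mono (Set.image_mono fun _ hw => lt_of_lt_of_le hw h)

lemma mulVec_mem_reachableLT {J : Type*} (x : J → Fin n → ℝ) (q : Q) {k : ℕ} {y : Fin n → ℝ}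
    (hy : y ∈ reachableLT A x k) : A q *ᵥ y ∈ reachableLT A x (k + 1) := by
  change y ∈ (reachableLT A x (k + 1)).comap (A q).mulVecLin
  refine (Submodule.span_le.2 ?_ : reachableLT A x k ≤ _) hy
  rintro _ ⟨⟨w, j⟩, hw, rfl⟩
  refine Submodule.subset_span ⟨(w ++ [q], j), ?_, ?_⟩
  · simpa using hw
  · simp [reachedState, wordProd_append, wordProd, Matrix.mulVec_mulVec]

lemma reachableLT_stable {J : Type*} (x : J → Fin n → ℝ) {k : ℕ}
    (h : reachableLT A x k = reachableLT A x (k + 1)) :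
    reachableLT A x (k + 1) = reachableLT A x (k + 2) := by
  refine (reachableLT_mono A x (Nat.le_succ _)).antisymm (Submodule.span_le.2 ?_)
  rintro _ ⟨⟨w, j⟩, hw, rfl⟩
  rcases List.eq_nil_or_concat w with rfl | ⟨u, q, rfl⟩
  · exact Submodule.subset_span ⟨([], j), by simp, rfl⟩
  · have hu : reachedState A x (u, j) ∈ reachableLT A x k := by
      rw [h]
      exact Submodule.subset_span ⟨(u, j), by simpa using hw, rfl⟩
    simpa [reachedState, wordProd_append, wordProd, Matrix.mulVec_mulVec] using
      mulVec_mem_reachableLT A x q hu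

lemma reachableLT_eq_of_le {J : Type*} (x : J → Fin n → ℝ) {k : ℕ} (h : n ≤ k) :
    reachableLT A x k = reachableLT A x n := by
  refine (Submodule.eq_of_le_of_finrank_eq (reachableLT_mono A x h) ?_).symm
  refine (Nat.stabilises_of_monotone (f := fun k => Module.finrank ℝ (reachableLT A x k))
    (fun _ _ h => Submodule.finrank_mono (reachableLT_mono A x h))
    (fun k => by simpa using Submodule.finrank_le (reachableLT A x k))
    (fun k hk => ?_) h).symm
  exact congrArg (fun W : Submodule ℝ (Fin n → ℝ) => Module.finrank ℝ W)
    (reachableLT_stable A x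
      (Submodule.eq_of_le_of_finrank_eq (reachableLT_mono A x (Nat.le_succ _)) hk))

variable (C : Q → Matrix (Fin p) (Fin n) ℝ)

lemma unobservableLT_anti : Antitone (unobservableLT A C) :=
  fun _ _ h _ hx v hv => hx v (hv.trans_le h)

lemma unobservableLT_stable {k : ℕ} (h : unobservableLT A C k = unobservableLT A C (k + 1)) :
    unobservableLT A C (k + 1) = unobservableLT A C (k + 2) := by
  refine le_antisymm (fun x hx v hv i => ?_) (unobservableLT_anti A C (Nat.le_succ _))
  cases v with
  | nil => exact hx [] (by simp) i
  | cons q u =>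
    have hq : A q *ᵥ x ∈ unobservableLT A C k := fun v' hv' i' => by
      rw [outputMap_mulVec]
      exact hx _ (by simpa using hv') i'
    rw [h] at hq
    rw [← outputMap_mulVec]
    exact hq u (by simpa using hv) i

lemma unobservableLT_eq_of_le {k : ℕ} (h : n ≤ k) :
    unobservableLT A C k = unobservableLT A C n := by
  have hle (k : ℕ) : Module.finrank ℝ (unobservableLT A C k) ≤ n := by
    simpa using Submodule.finrank_le (unobservableLT A C k)
  have hcancel {k l : ℕ} (hkl : n - Module.finrank ℝ (unobservableLT A C k) =
      n - Module.finrank ℝ (unobservableLT A C l)) :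
      Module.finrank ℝ (unobservableLT A C k) = Module.finrank ℝ (unobservableLT A C l) := by
    have := hle k
    have := hle l
    omega
  refine Submodule.eq_of_le_of_finrank_eq (unobservableLT_anti A C h) (hcancel ?_)
  refine Nat.stabilises_of_monotone
    (f := fun k => n - Module.finrank ℝ (unobservableLT A C k))
    (fun _ _ h => Nat.sub_le_sub_left (Submodule.finrank_mono (unobservableLT_anti A C h)) n)
    (fun k => Nat.sub_le _ _) (fun k hk => ?_) h
  exact congrArg (fun W : Submodule ℝ (Fin n → ℝ) => n - Module.finrank ℝ W)
    (unobservableLT_stable A C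
      (Submodule.eq_of_le_of_finrank_eq (unobservableLT_anti A C (Nat.le_succ _))
        (hcancel hk).symm).symm)

variable {A C} {B : Q → Matrix (Fin n) (Fin m) ℝ} {μ : Φ → Fin n → ℝ}
  {S1 : Q → Q → Fin m → List Q → Fin p → ℝ} {S2 : Φ → Q → List Q → Fin p → ℝ}

lemma IsLssRealization.hankelColumn_eq (h : IsLssRealization S1 S2 A B C μ)
    (wj : List Q × (Φ ⊕ Q × Fin m)) :
    hankelColumn S1 S2 wj = outputMap A C (reachedState A (initialVector B μ) wj) := by
  obtain ⟨w, f | ⟨q, z⟩⟩ := wj <;> ext ⟨v, q', r⟩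
  · simp [hankelColumn, lssEntry, (h _).2, outputMap_apply, reachedState, initialVector,
      wordProd_append]
  · simp [hankelColumn, lssEntry, (h _).1, outputMap_apply, reachedState, initialVector,
      wordProd_append]

lemma IsLssRealization.lssFullSpan_le (h : IsLssRealization S1 S2 A B C μ) :
    lssFullSpan S1 S2 ≤ LinearMap.range (outputMap A C) := by
  rw [lssFullSpan_eq, Submodule.span_le]
  rintro _ ⟨wj, rfl⟩
  rw [h.hankelColumn_eq]
  exact ⟨_, rfl⟩

lemma IsLssRealization.finiteDimensional (h : IsLssRealization S1 S2 A B C μ) :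
    FiniteDimensional ℝ (lssFullSpan S1 S2) :=
  Submodule.finiteDimensional_of_le h.lssFullSpan_le

lemma IsLssRealization.finrank_le (h : IsLssRealization S1 S2 A B C μ) :
    Module.finrank ℝ (lssFullSpan S1 S2) ≤ n := by
  simpa using (Submodule.finrank_mono h.lssFullSpan_le).trans
    (LinearMap.finrank_range_le (outputMap A C))

lemma IsLssRealization.hankelSpanLE_eq (h : IsLssRealization S1 S2 A B C μ) {N : ℕ}
    (hn : n ≤ N + 1) : hankelSpanLE S1 S2 N = lssFullSpan S1 S2 := by
  refine (hankelSpanLE_le_lssFullSpan S1 S2 N).antisymm ?_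
  have hmap : hankelSpanLE S1 S2 N =
      (reachableLT A (initialVector B μ) (N + 1)).map (outputMap A C) := by
    rw [reachableLT, Submodule.map_span, hankelSpanLE, Set.image_image]
    simp_rw [← h.hankelColumn_eq, Nat.lt_succ_iff]
  rw [hmap, lssFullSpan_eq, Submodule.span_le]
  rintro _ ⟨wj, rfl⟩
  rw [h.hankelColumn_eq, reachableLT_eq_of_le _ _ hn,
    ← reachableLT_eq_of_le A (initialVector B μ) (le_max_left n (wj.1.length + 1))]
  exact Submodule.mem_map_of_mem (Submodule.subset_span
    ⟨wj, (Nat.lt_succ_self _).trans_le (le_max_right _ _), rfl⟩)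

lemma IsLssRealization.restrictRows_injective (h : IsLssRealization S1 S2 A B C μ) {N : ℕ}
    (hn : n ≤ N + 1) :
    Function.Injective ((restrictRows Q p N).domRestrict (lssFullSpan S1 S2)) := by
  rw [injective_iff_map_eq_zero]
  rintro ⟨c, hc⟩ h0
  obtain ⟨x, rfl⟩ := h.lssFullSpan_le hc
  have hx : x ∈ unobservableLT A C (N + 1) := fun v hv i =>
    congrFun h0 (⟨v, Nat.le_of_lt_succ hv⟩, i)
  rw [unobservableLT_eq_of_le A C hn] at hx
  ext ⟨v, i⟩
  rw [← unobservableLT_eq_of_le A C (le_max_left n (v.length + 1))] at hx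
  exact hx v ((Nat.lt_succ_self _).trans_le (le_max_right _ _)) i

lemma IsLssRealization.lssHankelRank_eq_finrank (h : IsLssRealization S1 S2 A B C μ) {N : ℕ}
    (hn : n ≤ N + 1) :
    lssHankelRank S1 S2 N N = Module.finrank ℝ (lssFullSpan S1 S2) := by
  rw [lssHankelRank_eq, h.hankelSpanLE_eq hn, ← LinearMap.range_domRestrict]
  exact LinearMap.finrank_range_of_inj (h.restrictRows_injective hn)

end Realization

/-- if the span of the columns of the full Hankel matrix `H_Φ` is
finite-dimensional of dimension `rank H_{Φ,N,N}` (for `N > 0`), then the three ranks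
agree, and there is a complete LSS realization of the data of dimension
`rank H_{Φ,N,N}`, which is minimal.  Moreover, if there is a complete LSS realization
of dimension `≤ N+1`, then the span of the columns of `H_Φ` is finite-dimensional of
dimension `rank H_{Φ,N,N}`. -/
theorem stmt17 {Q Φ : Type*} [Fintype Q] {p m : ℕ}
    (S1 : Q → Q → Fin m → List Q → Fin p → ℝ)
    (S2 : Φ → Q → List Q → Fin p → ℝ)
    (N : ℕ) (hN : 0 < N) :
    (Module.rank ℝ (lssFullSpan S1 S2) = (lssHankelRank S1 S2 N N : Cardinal) →
      (lssHankelRank S1 S2 N N = lssHankelRank S1 S2 (N + 1) N ∧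
        lssHankelRank S1 S2 N N = lssHankelRank S1 S2 N (N + 1)) ∧
      (∃ (A : Q → Matrix (Fin (lssHankelRank S1 S2 N N))
              (Fin (lssHankelRank S1 S2 N N)) ℝ)
         (B : Q → Matrix (Fin (lssHankelRank S1 S2 N N)) (Fin m) ℝ)
         (C : Q → Matrix (Fin p) (Fin (lssHankelRank S1 S2 N N)) ℝ)
         (μ : Φ → Fin (lssHankelRank S1 S2 N N) → ℝ),
         IsLssRealization S1 S2 A B C μ) ∧
      (∀ (n : ℕ) (A : Q → Matrix (Fin n) (Fin n) ℝ) (B : Q → Matrix (Fin n) (Fin m) ℝ)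
         (C : Q → Matrix (Fin p) (Fin n) ℝ) (μ : Φ → Fin n → ℝ),
         IsLssRealization S1 S2 A B C μ → lssHankelRank S1 S2 N N ≤ n)) ∧
    ((∃ (n : ℕ) (_ : n ≤ N + 1) (A : Q → Matrix (Fin n) (Fin n) ℝ)
        (B : Q → Matrix (Fin n) (Fin m) ℝ) (C : Q → Matrix (Fin p) (Fin n) ℝ)
        (μ : Φ → Fin n → ℝ), IsLssRealization S1 S2 A B C μ) →
      Module.rank ℝ (lssFullSpan S1 S2) = (lssHankelRank S1 S2 N N : Cardinal)) := by
  refine ⟨fun hrank => ?_, ?_⟩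
  · have hfd : FiniteDimensional ℝ (lssFullSpan S1 S2) :=
      Module.rank_lt_aleph0_iff.1 (hrank ▸ Cardinal.natCast_lt_aleph0)
    have hfin := Module.finrank_eq_of_rank_eq hrank
    refine ⟨⟨?_, ?_⟩, exists_isLssRealization S1 S2 (Module.finBasisOfFinrankEq _ _ hfin),
      fun n A B C μ h => hfin ▸ h.finrank_le⟩
    · exact (lssHankelRank_mono_left S1 S2 (Nat.le_succ N) N).antisymm
        ((lssHankelRank_le_finrank S1 S2 _ _).trans_eq hfin)
    · exact (lssHankelRank_mono_right S1 S2 N (Nat.le_succ N)).antisymm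
        ((lssHankelRank_le_finrank S1 S2 _ _).trans_eq hfin)
  · rintro ⟨n, hn, A, B, C, μ, h⟩
    have := h.finiteDimensional
    rw [h.lssHankelRank_eq_finrank hn, Module.finrank_eq_rank]
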